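/- arXiv:1612.08307 — 6 statements merged into one kernel-verified Lean document; each statement's English description precedes it below -/
import Mathlib

section
/- Let a be a real number with a ∉ {-2/3, -1/2, -1/6, 0, 1}. Then ((a+1)/(a-1)) · (1 - 1/a²) · (1 - 1/(2a+1)²) · (1 - 1/(3a+2)²) · (1 - 1/(6a+1)²) = ((1 + 1/(2a+1)) · (1 + 1/(3a+2)) · (1 + 1/(6a+1)))². -/
theorem ramanujan_identity_squared (a : ℝ)
    (ha : a ≠ -2/3) (ha' : a ≠ -1/2) (ha'' : a ≠ -1/6) (ha''' : a ≠ 0) (ha'''' : a ≠ 1) :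
    (a + 1) / (a - 1) * (1 - 1 / a ^ 2) * (1 - 1 / (2 * a + 1) ^ 2) *
        (1 - 1 / (3 * a + 2) ^ 2) * (1 - 1 / (6 * a + 1) ^ 2) =
      ((1 + 1 / (2 * a + 1)) * (1 + 1 / (3 * a + 2)) * (1 + 1 / (6 * a + 1))) ^ 2 := by
  have h₁ : a - 1 ≠ 0 := sub_ne_zero.mpr ha''''
  have h₂ : 2 * a + 1 ≠ 0 := fun h => ha' (by linarith)
  have h₃ : 3 * a + 2 ≠ 0 := fun h => ha (by linarith)
  have h₄ : 6 * a + 1 ≠ 0 := fun h => ha'' (by linarith)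
  have one_sub (x : ℝ) (hx : x ≠ 0) : 1 - 1 / x ^ 2 = (x - 1) * (x + 1) / x ^ 2 := by
    field_simp
    ring
  have one_add (x : ℝ) (hx : x ≠ 0) : 1 + 1 / x = (x + 1) / x := by
    field_simp
  rw [one_sub _ ha''', one_sub _ h₂, one_sub _ h₃, one_sub _ h₄, one_add _ h₂, one_add _ h₃,
    one_add _ h₄]
  field_simp
  ring
end

section
/- Let a be a real number with a ∉ {-2/3, -1/2, -1/6, 0}. Then ((a+1)/a)² · (1 - 1/(2a+1)²) · (1 - 1/(3a+2)²) · (1 - 1/(6a+1)²) = ((1 + 1/(2a+1)) · (1 + 1/(3a+2)) · (1 + 1/(6a+1)))². -/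
theorem ramanujan_identity_alternative_squared (a : ℝ)
    (ha : a ≠ -2/3) (ha' : a ≠ -1/2) (ha'' : a ≠ -1/6) (ha''' : a ≠ 0) :
    ((a + 1) / a) ^ 2 * (1 - 1 / (2 * a + 1) ^ 2) * (1 - 1 / (3 * a + 2) ^ 2) *
        (1 - 1 / (6 * a + 1) ^ 2) =
      ((1 + 1 / (2 * a + 1)) * (1 + 1 / (3 * a + 2)) * (1 + 1 / (6 * a + 1))) ^ 2 := by
  have h₁ : 2 * a + 1 ≠ 0 := fun h => ha' (by linarith)
  have h₂ : 3 * a + 2 ≠ 0 := fun h => ha (by linarith)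
  have h₃ : 6 * a + 1 ≠ 0 := fun h => ha'' (by linarith)
  have e₁ : 1 - 1 / (2 * a + 1) ^ 2 = 4 * a * (a + 1) / (2 * a + 1) ^ 2 := by
    rw [eq_div_iff (pow_ne_zero 2 h₁), sub_mul, div_mul_cancel₀ _ (pow_ne_zero 2 h₁)]
    ring
  have e₂ : 1 - 1 / (3 * a + 2) ^ 2 = 3 * (a + 1) * (3 * a + 1) / (3 * a + 2) ^ 2 := by
    rw [eq_div_iff (pow_ne_zero 2 h₂), sub_mul, div_mul_cancel₀ _ (pow_ne_zero 2 h₂)]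
    ring
  have e₃ : 1 - 1 / (6 * a + 1) ^ 2 = 12 * a * (3 * a + 1) / (6 * a + 1) ^ 2 := by
    rw [eq_div_iff (pow_ne_zero 2 h₃), sub_mul, div_mul_cancel₀ _ (pow_ne_zero 2 h₃)]
    ring
  rw [e₁, e₂, e₃, one_add_div h₁, one_add_div h₂, one_add_div h₃]
  field_simp
  ring
end

section
/- For all integers n ≥ m ≥ 2, √(((m(m-1)+1)/(m(m-1))) · ((n(n+1))/(n(n+1)+1)) · ∏_{k=m}^{n} (1 - 1/k⁶)) = ∏_{k=m}^{n} (1 + 1/k³). -/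
theorem telescoping_factor {x : ℝ} (hx : 0 < x) :
    (x + 1) * (x + 1 + 1) / ((x + 1) * (x + 1 + 1) + 1) * (1 - 1 / (x + 1) ^ 3) =
      x * (x + 1) / (x * (x + 1) + 1) * (1 + 1 / (x + 1) ^ 3) := by
  have h₁ : (x + 1) * (x + 1 + 1) + 1 ≠ 0 := by positivity
  have h₂ : x * (x + 1) + 1 ≠ 0 := by positivity
  have h₃ : x + 1 ≠ 0 := by positivity
  rw [div_mul_eq_mul_div, div_mul_eq_mul_div, div_eq_div_iff h₁ h₂]
  field_simp
  ring

theorem prod_one_sub_inv_cube (m n : ℕ) (hm : 2 ≤ m) (hmn : m ≤ n) :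
    (m * (m - 1) + 1 : ℝ) / (m * (m - 1)) * ((n * (n + 1) : ℝ) / (n * (n + 1) + 1)) *
        ∏ k ∈ Finset.Icc m n, (1 - 1 / (k : ℝ) ^ 3) =
      ∏ k ∈ Finset.Icc m n, (1 + 1 / (k : ℝ) ^ 3) := by
  induction n, hmn using Nat.le_induction with
  | base =>
    obtain ⟨j, rfl⟩ : ∃ j, m = j + 1 := ⟨m - 1, by omega⟩
    have hj : (0 : ℝ) < j := by exact_mod_cast (by omega : 0 < j)
    simp only [Finset.Icc_self, Finset.prod_singleton]
    push_cast
    rw [mul_assoc, telescoping_factor hj, add_sub_cancel_right]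
    have h : (j : ℝ) * (j + 1) + 1 ≠ 0 := by positivity
    field_simp
  | succ n hmn ih =>
    have hn : (0 : ℝ) < n := by exact_mod_cast (by omega : 0 < n)
    rw [Finset.prod_Icc_succ_top (by omega), Finset.prod_Icc_succ_top (by omega), ← ih]
    push_cast
    linear_combination (m * (m - 1) + 1 : ℝ) / (m * (m - 1)) *
      (∏ k ∈ Finset.Icc m n, (1 - 1 / (k : ℝ) ^ 3)) * telescoping_factor hn

theorem sqrt_prod_one_sub_inv_sixth (m n : ℕ) (hm : 2 ≤ m) (hmn : m ≤ n) :
    Real.sqrt ((m * (m - 1) + 1 : ℝ) / (m * (m - 1)) * ((n * (n + 1) : ℝ) / (n * (n + 1) + 1)) *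
        ∏ k ∈ Finset.Icc m n, (1 - 1 / (k : ℝ) ^ 6)) =
      ∏ k ∈ Finset.Icc m n, (1 + 1 / (k : ℝ) ^ 3) := by
  have h : ∏ k ∈ Finset.Icc m n, (1 - 1 / (k : ℝ) ^ 6) =
      (∏ k ∈ Finset.Icc m n, (1 - 1 / (k : ℝ) ^ 3)) *
        ∏ k ∈ Finset.Icc m n, (1 + 1 / (k : ℝ) ^ 3) := by
    rw [← Finset.prod_mul_distrib]
    refine Finset.prod_congr rfl fun k _ => ?_
    ring
  rw [h, ← mul_assoc, prod_one_sub_inv_cube m n hm hmn]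
  exact Real.sqrt_mul_self (Finset.prod_nonneg fun k _ => by positivity)
end

section
/- For all integers n ≥ m ≥ 2, ∏_{k=m}^{n} (k³+1)/(k³-1) = ((m(m-1)+1)/(m(m-1))) · ((n(n+1))/(n(n+1)+1)). -/
theorem cube_succ_div_pred_eq {x : ℝ} (hx : 1 < x) :
    (x ^ 3 + 1) / (x ^ 3 - 1) =
      (x * (x - 1) + 1) / (x * (x - 1)) * (x * (x + 1) / (x * (x + 1) + 1)) := by
  have h₀ : x ≠ 0 := by positivity
  have h₁ : x - 1 ≠ 0 := by linarith
  have h₂ : x * (x + 1) + 1 ≠ 0 := by positivity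
  have h₃ : x ^ 3 - 1 = (x - 1) * (x * (x + 1) + 1) := by ring
  rw [h₃]
  field_simp
  ring

theorem prod_cube_succ_div_pred (m n : ℕ) (hm : 2 ≤ m) (hmn : m ≤ n) :
    ∏ k ∈ Finset.Icc m n, ((k : ℝ) ^ 3 + 1) / ((k : ℝ) ^ 3 - 1) =
      (m * (m - 1) + 1 : ℝ) / (m * (m - 1)) * ((n * (n + 1) : ℝ) / (n * (n + 1) + 1)) := by
  induction n, hmn using Nat.le_induction with
  | base =>
    rw [Finset.Icc_self, Finset.prod_singleton]
    exact cube_succ_div_pred_eq (by exact_mod_cast hm)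
  | succ n hmn ih =>
    have hn : (0 : ℝ) < n := by exact_mod_cast (by omega : 0 < n)
    rw [← Finset.insert_Icc_right_eq_Icc_add_one (by omega), Finset.prod_insert (by simp), ih,
      cube_succ_div_pred_eq (by push_cast; linarith)]
    push_cast
    have h : ((n : ℝ) + 1) * (n + 1 - 1) = n * (n + 1) := by ring
    have h₁ : (n : ℝ) * (n + 1) ≠ 0 := by positivity
    have h₂ : (n : ℝ) * (n + 1) + 1 ≠ 0 := by positivity
    rw [h, mul_comm, mul_assoc, ← mul_assoc (_ / _) (_ / _) (_ / _), div_mul_div_cancel₀' h₁,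
      div_self h₂, one_mul]
end

section
/- The infinite product over all prime numbers p of (p² + 1)/(p² - 1) converges and equals 5/2. -/
/-- The Euler product over the primes of the real series `∑ 1 / n ^ k`, for `k ≠ 0`. -/
theorem hasProd_primes_one_sub_one_div_pow_inv {k : ℕ} (hk : k ≠ 0) {a : ℝ}
    (h : HasSum (fun n : ℕ => (1 : ℝ) / (n : ℝ) ^ k) a) :
    HasProd (fun p : Nat.Primes => (1 - (1 : ℝ) / (p : ℝ) ^ k)⁻¹) a := by
  let f : ℕ →*₀ ℝ :=
    { toFun := fun n => 1 / (n : ℝ) ^ k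
      map_zero' := by simp [hk]
      map_one' := by simp
      map_mul' := fun m n => by simp [mul_pow, mul_comm] }
  have hsum : Summable (‖f ·‖) := h.summable.norm
  have key := EulerProduct.eulerProduct_completely_multiplicative_hasProd hsum
  rwa [show ∑' n, f n = a from h.tsum_eq] at key

theorem hasProd_primes_sq_add_one_div_sq_sub_one :
    HasProd (fun p : Nat.Primes => ((p : ℝ) ^ 2 + 1) / ((p : ℝ) ^ 2 - 1)) (5 / 2) := by
  have h2 := hasProd_primes_one_sub_one_div_pow_inv two_ne_zero hasSum_zeta_two
  have h4 := hasProd_primes_one_sub_one_div_pow_inv four_ne_zero hasSum_zeta_four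
  convert! (h2.mul h2).div₀ h4 (by positivity) using 1
  · funext p
    have hp : (1 : ℝ) < p := by exact_mod_cast p.prop.one_lt
    have h₀ : (p : ℝ) ≠ 0 := by positivity
    have h₁ : (p : ℝ) ^ 2 - 1 ≠ 0 := by nlinarith
    have h₂ : (p : ℝ) ^ 2 + 1 ≠ 0 := by positivity
    have e₂ : 1 - 1 / (p : ℝ) ^ 2 = ((p : ℝ) ^ 2 - 1) / (p : ℝ) ^ 2 := by field_simp
    have e₄ : 1 - 1 / (p : ℝ) ^ 4 =
        ((p : ℝ) ^ 2 - 1) * ((p : ℝ) ^ 2 + 1) / (p : ℝ) ^ 4 := by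
      field_simp
      ring
    rw [e₂, e₄]
    field_simp
  · field_simp
    norm_num

theorem tprod_primes_sq_add_one_div_sq_sub_one :
    Multipliable (fun p : Nat.Primes => ((p : ℝ) ^ 2 + 1) / ((p : ℝ) ^ 2 - 1)) ∧
    ∏' p : Nat.Primes, ((p : ℝ) ^ 2 + 1) / ((p : ℝ) ^ 2 - 1) = 5 / 2 :=
  ⟨hasProd_primes_sq_add_one_div_sq_sub_one.multipliable,
    hasProd_primes_sq_add_one_div_sq_sub_one.tprod_eq⟩
end

section
/- Let s be a complex number with Re(s) > 1. Then the infinite product over all prime numbers p of (p^s + 1)/(p^s - 1) converges and equals ζ(s)²/ζ(2s), where ζ denotes the Riemann zeta function. -/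
theorem one_lt_norm_prime_cpow (p : Nat.Primes) {s : ℂ} (hs : 0 < s.re) :
    1 < ‖(p : ℂ) ^ s‖ := by
  rw [Complex.norm_natCast_cpow_of_pos p.2.pos]
  exact Real.one_lt_rpow (by exact_mod_cast p.2.one_lt) hs

theorem euler_factor_sq_div {a : ℂ} (ha : 1 < ‖a‖) :
    (1 - a⁻¹)⁻¹ ^ 2 / (1 - (a ^ 2)⁻¹)⁻¹ = (a + 1) / (a - 1) := by
  have h0 : a ≠ 0 := by rintro rfl; norm_num at ha
  have h1 : a - 1 ≠ 0 := by
    intro h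
    rw [sub_eq_zero.mp h] at ha
    norm_num at ha
  field_simp
  ring

theorem hasProd_primes_cpow_ratio {s : ℂ} (hs : 1 < s.re) :
    HasProd (fun p : Nat.Primes => ((p : ℂ) ^ s + 1) / ((p : ℂ) ^ s - 1))
      (riemannZeta s ^ 2 / riemannZeta (2 * s)) := by
  have hs2 : 1 < (2 * s).re := by
    simp only [Complex.mul_re, Complex.re_ofNat, Complex.im_ofNat, zero_mul, sub_zero]
    linarith
  have hζ := riemannZeta_eulerProduct_hasProd hs
  rw [sq]
  refine ((hζ.mul hζ).div₀ (riemannZeta_eulerProduct_hasProd hs2)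
    (riemannZeta_ne_zero_of_one_lt_re hs2)).congr_fun fun p => ?_
  rw [← euler_factor_sq_div (one_lt_norm_prime_cpow p (by linarith)), sq, Complex.cpow_neg,
    Complex.cpow_neg, Complex.cpow_ofNat_mul]

theorem tprod_primes_cpow_ratio (s : ℂ) (hs : 1 < s.re) :
    Multipliable (fun p : Nat.Primes => ((p : ℂ) ^ s + 1) / ((p : ℂ) ^ s - 1)) ∧
    ∏' p : Nat.Primes, ((p : ℂ) ^ s + 1) / ((p : ℂ) ^ s - 1) =
      riemannZeta s ^ 2 / riemannZeta (2 * s) :=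
  ⟨(hasProd_primes_cpow_ratio hs).multipliable, (hasProd_primes_cpow_ratio hs).tprod_eq⟩
end
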